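/- Let E be a finite set and let {S_1|T_1, …, S_k|T_k} be a flag of bisubsets of E with S_1 ⊆ … ⊆ S_k and T_1 ⊇ … ⊇ T_k; set S_0 = ∅, T_0 = E, S_{k+1} = E, T_{k+1} = ∅, and define the gaps D_j = (S_{j+1} − S_j) ∩ (T_j − T_{j+1}) for 0 ≤ j ≤ k. Then the gaps D_0, …, D_k are pairwise disjoint and their union equals E − ∪_{i=1}^{k} (S_i ∩ T_i). In particular, an element e ∈ E lies in no gap if and only if e ∈ S_i ∩ T_i for some 1 ≤ i ≤ k. -/

import Mathlib

variable {α : Type*} [Fintype α] [DecidableEq α]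

/-- A bisubset of a finite set `E` (here, a finite type `α`) is an ordered pair `S|T` of
nonempty subsets of `E` such that `S ∪ T = E` and `(S, T) ≠ (E, E)`. -/
def IsBisubset (p : Finset α × Finset α) : Prop :=
  p.1.Nonempty ∧ p.2.Nonempty ∧ p.1 ∪ p.2 = Finset.univ ∧ p ≠ (Finset.univ, Finset.univ)

/-- The `j`-th gap of a flag of bisubsets given by sequences `S` and `T`:
`D_j = (S_{j+1} − S_j) ∩ (T_j − T_{j+1})`. -/
def gapOf (S T : ℕ → Finset α) (j : ℕ) : Finset α :=
  (S (j + 1) \ S j) ∩ (T j \ T (j + 1))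

theorem subset_of_forall_subset_succ {β : Type*} {S : ℕ → Finset β} {k : ℕ}
    (hS : ∀ j ≤ k, S j ⊆ S (j + 1)) {i j : ℕ} (hij : i ≤ j) (hj : j ≤ k + 1) : S i ⊆ S j := by
  induction j, hij using Nat.le_induction with
  | base => exact subset_rfl
  | succ n _ ih => exact (ih (by omega)).trans (hS n (by omega))

theorem subset_of_forall_succ_subset {β : Type*} {T : ℕ → Finset β} {k : ℕ}
    (hT : ∀ j ≤ k, T (j + 1) ⊆ T j) {i j : ℕ} (hij : i ≤ j) (hj : j ≤ k + 1) : T j ⊆ T i := by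
  induction j, hij using Nat.le_induction with
  | base => exact subset_rfl
  | succ n _ ih => exact (hT n (by omega)).trans (ih (by omega))

theorem mem_gapOf {β : Type*} [DecidableEq β] {S T : ℕ → Finset β} {j : ℕ} {e : β} :
    e ∈ gapOf S T j ↔ (e ∈ S (j + 1) ∧ e ∉ S j) ∧ e ∈ T j ∧ e ∉ T (j + 1) := by
  simp [gapOf]

/-- **The gap sequence of a flag of bisubsets.** Let `{S_1|T_1, …, S_k|T_k}` be a flag of
bisubsets of `E` with `S_1 ⊆ ⋯ ⊆ S_k` and `T_1 ⊇ ⋯ ⊇ T_k`; set `S_0 = ∅`, `T_0 = E`,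
`S_{k+1} = E`, `T_{k+1} = ∅`, and let `D_j = (S_{j+1} − S_j) ∩ (T_j − T_{j+1})` for
`0 ≤ j ≤ k` be the gaps.  Then the gaps are pairwise disjoint, their union is
`E − ∪_{i=1}^{k} (S_i ∩ T_i)`, and an element `e` lies in no gap if and only if
`e ∈ S_i ∩ T_i` for some `1 ≤ i ≤ k`. -/
theorem gap_sequence (k : ℕ) (S T : ℕ → Finset α)
    (hS0 : S 0 = ∅) (hT0 : T 0 = Finset.univ)
    (hStop : S (k + 1) = Finset.univ) (hTtop : T (k + 1) = ∅)
    (hbisub : ∀ j, 1 ≤ j → j ≤ k → IsBisubset (S j, T j))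
    (hSmono : ∀ j ≤ k, S j ⊆ S (j + 1))
    (hTmono : ∀ j ≤ k, T (j + 1) ⊆ T j)
    (hflag : (Finset.Icc 1 k).biUnion (fun i => S i ∩ T i) ≠ Finset.univ) :
    (∀ i ≤ k, ∀ j ≤ k, i ≠ j → Disjoint (gapOf S T i) (gapOf S T j)) ∧
    ((Finset.range (k + 1)).biUnion (gapOf S T) =
      Finset.univ \ (Finset.Icc 1 k).biUnion (fun i => S i ∩ T i)) ∧
    (∀ e : α, (∀ j ≤ k, e ∉ gapOf S T j) ↔ ∃ i, 1 ≤ i ∧ i ≤ k ∧ e ∈ S i ∩ T i) := by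
  have hlt : ∀ i j, i < j → j ≤ k → Disjoint (gapOf S T i) (gapOf S T j) := by
    intro i j hij hj
    rw [Finset.disjoint_left]
    intro e hi hj'
    rw [mem_gapOf] at hi hj'
    exact hj'.1.2 (subset_of_forall_subset_succ hSmono hij (by omega) hi.1.1)
  have hgap : ∀ e : α, (∀ j ≤ k, e ∉ gapOf S T j) ↔ ∃ i, 1 ≤ i ∧ i ≤ k ∧ e ∈ S i ∩ T i := by
    intro e
    constructor
    · intro h
      have hex : ∃ m, e ∈ S m := ⟨k + 1, by simp [hStop]⟩
      obtain ⟨m, hm, hmin⟩ : ∃ m, e ∈ S m ∧ ∀ j < m, e ∉ S j :=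
        ⟨Nat.find hex, Nat.find_spec hex, fun j hj => Nat.find_min hex hj⟩
      have hmk : m ≤ k + 1 := by
        by_contra! hlt'
        exact hmin _ hlt' (by simp [hStop])
      obtain _ | n := m
      · simp [hS0] at hm
      have hn : e ∉ S n := hmin n (Nat.lt_succ_self n)
      have hTn : e ∈ T n := by
        rcases Nat.eq_zero_or_pos n with rfl | hpos
        · simp [hT0]
        · have hu : e ∈ S n ∪ T n := by
            rw [(hbisub n hpos (by omega)).2.2.1]
            exact Finset.mem_univ e
          exact (Finset.mem_union.mp hu).resolve_left hn
      have hTm : e ∈ T (n + 1) := by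
        by_contra hT
        exact h n (by omega) (mem_gapOf.mpr ⟨⟨hm, hn⟩, hTn, hT⟩)
      have hne : n ≠ k := by
        rintro rfl
        simp [hTtop] at hTm
      exact ⟨n + 1, by omega, by omega, Finset.mem_inter.mpr ⟨hm, hTm⟩⟩
    · rintro ⟨i, -, hik, he⟩ j hj hg
      rw [Finset.mem_inter] at he
      rw [mem_gapOf] at hg
      rcases Nat.lt_or_ge j i with hji | hij
      · exact hg.2.2 (subset_of_forall_succ_subset hTmono hji (by omega) he.2)
      · exact hg.1.2 (subset_of_forall_subset_succ hSmono hij (by omega) he.1)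
  refine ⟨?_, ?_, hgap⟩
  · intro i hi j hj hij
    rcases Nat.lt_or_gt_of_ne hij with h | h
    · exact hlt i j h hj
    · exact (hlt j i h hi).symm
  · ext e
    have := not_congr (hgap e)
    push Not at this
    simpa [Nat.lt_succ_iff, and_imp] using this
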